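/- arXiv:2503.04203 — 13 statements merged into one kernel-verified Lean document; each statement's English description precedes it below -/
import Mathlib

section
/- Let n ≥ 1, let s be a fixed index in {1,…,n}, let γ, γ' ∈ (0,1), let r ∈ ℝ, let c : {1,…,n} → ℝ satisfy Σ_{i=1}^n c_i = γ − 1, and let V : {1,…,n} → ℝ. Define c̄ by c̄_i = c_i for i ≠ s and c̄_s = c_s − (γ − γ'), and define V̄ by V̄(s) = V(s)·(1−γ)/(1−γ') and V̄(i) = V(i) + (V̄(s) − V(s)) for i ≠ s. Then r + Σ_{i=1}^n c_i V(i) = r + Σ_{i=1}^n c̄_i V̄(i); that is, the transformation J_s^{γ'} preserves the advantage of every action with respect to every policy. -/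
/-- Part (1) of the theorem on the discount-factor transformation `J_s^{γ'}`:
it preserves the advantage `r + ∑ i, c i * V i` of every action with respect
to every (pseudo-)policy. -/
theorem stmt_0 (n : ℕ) (hn : 1 ≤ n) (s : Fin n) (γ γ' r : ℝ)
    (hγ0 : 0 < γ) (hγ1 : γ < 1) (hγ'0 : 0 < γ') (hγ'1 : γ' < 1)
    (c V cbar Vbar : Fin n → ℝ)
    (hc : ∑ i, c i = γ - 1)
    (hcbar : ∀ i, cbar i = if i = s then c i - (γ - γ') else c i)
    (hVbars : Vbar s = V s * (1 - γ) / (1 - γ'))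
    (hVbar : ∀ i, i ≠ s → Vbar i = V i + (Vbar s - V s)) :
    r + ∑ i, c i * V i = r + ∑ i, cbar i * Vbar i := by
  have hV : ∀ i, Vbar i = V i + (Vbar s - V s) := fun i => by
    by_cases h : i = s
    · subst h; ring
    · exact hVbar i h
  have hs : Vbar s * (1 - γ') = V s * (1 - γ) := by
    rw [hVbars, div_mul_cancel₀ _ (sub_ne_zero.mpr hγ'1.ne')]
  have hterm : ∀ i, cbar i * Vbar i =
      c i * V i + c i * (Vbar s - V s) - if i = s then (γ - γ') * Vbar s else 0 := fun i => by
    rw [hcbar i]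
    split_ifs with h
    · subst h; ring
    · rw [hV i]; ring
  have hsum : ∑ i, cbar i * Vbar i =
      ∑ i, c i * V i + (γ - 1) * (Vbar s - V s) - (γ - γ') * Vbar s := by
    simp only [hterm, Finset.sum_sub_distrib, Finset.sum_add_distrib, ← Finset.sum_mul, hc,
      Finset.sum_ite_eq', Finset.mem_univ, if_true]
  rw [hsum]
  linear_combination hs
end

section
/- Consider a finite discounted MDP with state set S of size n, action set A, state map st : A → S (at least one action per state), probability vectors p^a, rewards r^a, and discount factor γ ∈ (0,1). Fix a state s and γ' ∈ (0,γ), and assume γ·p^a_s ≥ γ − γ' for every action a ∈ A. Define new probability vectors p'^a by p'^a_i = γ p^a_i / γ' for i ≠ s and p'^a_s = (γ p^a_s − (γ − γ')) / γ'. Then: (i) each p'^a is a probability vector (nonnegative entries summing to 1); and, letting V'^π denote the value vector of a policy π in the new MDP with the same states, actions, state map, and rewards but probabilities p'^a and discount γ', (ii) V'^π(s) = V^π(s)·(1−γ)/(1−γ') and V'^π(i) − V'^π(j) = V^π(i) − V^π(j) for all states i, j (so sp(V'^π) = sp(V^π)); and (iii) for every action a and policy π, the advantage of a with respect to V'^π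 in the new MDP equals the advantage of a with respect to V^π in the original MDP: r^a + γ' Σ_i p'^a_i V'^π(i) − V'^π(st(a)) = r^a + γ Σ_i p^a_i V^π(i) − V^π(st(a)). -/
/-- The span `max_i V i - min_i V i` of a value vector. -/
noncomputable def sp {S : Type} [Fintype S] [Nonempty S] (V : S → ℝ) : ℝ :=
  Finset.univ.sup' Finset.univ_nonempty V - Finset.univ.inf' Finset.univ_nonempty V

lemma sp_add_const {S : Type} [Fintype S] [Nonempty S] (V : S → ℝ) (c : ℝ) :
    sp (fun i => V i + c) = sp V := by
  have hinf : (Finset.univ.inf' Finset.univ_nonempty fun i => V i + c)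
      = Finset.univ.inf' Finset.univ_nonempty V + c :=
    (map_finset_inf' (OrderIso.addRight c) Finset.univ_nonempty V).symm
  unfold sp
  rw [← Finset.sup'_add, hinf]
  ring

/-- The evaluation equation of a stochastic matrix with discount factor in `(0, 1)`
has at most one solution. -/
lemma eq_of_discounted_eval {S : Type} [Fintype S] [Nonempty S] {P : S → S → ℝ}
    (hP0 : ∀ i j, 0 ≤ P i j) (hP1 : ∀ i, ∑ j, P i j = 1) {γ : ℝ} (hγ0 : 0 ≤ γ) (hγ1 : γ < 1)
    {ρ U W : S → ℝ} (hU : ∀ i, U i = ρ i + γ * ∑ j, P i j * U j)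
    (hW : ∀ i, W i = ρ i + γ * ∑ j, P i j * W j) : U = W := by
  obtain ⟨m, hm⟩ := Finite.exists_max (fun i => |U i - W i|)
  have hdiff : U m - W m = γ * ∑ j, P m j * (U j - W j) := by
    rw [hU m, hW m]
    simp only [mul_sub, Finset.sum_sub_distrib]
    ring
  have hsum : |∑ j, P m j * (U j - W j)| ≤ |U m - W m| :=
    calc |∑ j, P m j * (U j - W j)| ≤ ∑ j, |P m j * (U j - W j)| :=
          Finset.abs_sum_le_sum_abs _ _
      _ ≤ ∑ j, P m j * |U m - W m| := by
          refine Finset.sum_le_sum fun j _ => ?_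
          rw [abs_mul, abs_of_nonneg (hP0 m j)]
          exact mul_le_mul_of_nonneg_left (hm j) (hP0 m j)
      _ = |U m - W m| := by rw [← Finset.sum_mul, hP1, one_mul]
  have hle : |U m - W m| ≤ γ * |U m - W m| := by
    conv_lhs => rw [hdiff, abs_mul, abs_of_nonneg hγ0]
    exact mul_le_mul_of_nonneg_left hsum hγ0
  have hzero : |U m - W m| ≤ 0 := by nlinarith [abs_nonneg (U m - W m)]
  funext i
  exact sub_eq_zero.mp (abs_nonpos_iff.mp ((hm i).trans hzero))

/-- The safe application of the transformation `J_s^{γ'}` to an actual MDP: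
the new transition probabilities form probability vectors, policy values are
transformed as prescribed (value at `s` rescaled, differences and span
preserved), and all advantages are preserved. -/
theorem stmt_2 {S A : Type} [Fintype S] [Nonempty S] [DecidableEq S] [Fintype A]
    (st : A → S) (hst : ∀ s : S, ∃ a, st a = s)
    (p : A → S → ℝ) (hp0 : ∀ a i, 0 ≤ p a i) (hp1 : ∀ a, ∑ i, p a i = 1)
    (r : A → ℝ) (γ : ℝ) (hγ0 : 0 < γ) (hγ1 : γ < 1)
    (s : S) (γ' : ℝ) (hγ'0 : 0 < γ') (hγ'γ : γ' < γ)
    (hsafe : ∀ a, γ - γ' ≤ γ * p a s)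
    (p' : A → S → ℝ)
    (hp' : ∀ a i, p' a i =
      if i = s then (γ * p a s - (γ - γ')) / γ' else γ * p a i / γ') :
    (∀ a, (∀ i, 0 ≤ p' a i) ∧ ∑ i, p' a i = 1) ∧
    (∀ π : S → A, (∀ i, st (π i) = i) →
      ∀ V V' : S → ℝ,
        (∀ i, V i = r (π i) + γ * ∑ j, p (π i) j * V j) →
        (∀ i, V' i = r (π i) + γ' * ∑ j, p' (π i) j * V' j) →
        V' s = V s * (1 - γ) / (1 - γ') ∧
        (∀ i j, V' i - V' j = V i - V j) ∧
        sp V' = sp V ∧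
        (∀ a, r a + γ' * ∑ i, p' a i * V' i - V' (st a)
            = r a + γ * ∑ i, p a i * V i - V (st a))) := by
  have hsum : ∀ a (W : S → ℝ),
      γ' * ∑ i, p' a i * W i = γ * ∑ i, p a i * W i - (γ - γ') * W s := by
    intro a W
    have hterm : ∀ i, γ' * (p' a i * W i)
        = γ * (p a i * W i) - (if i = s then (γ - γ') * W s else 0) := by
      intro i
      rw [hp' a i]
      split_ifs with h
      · subst h
        field_simp
      · field_simp
        ring
    simp only [Finset.mul_sum, hterm, Finset.sum_sub_distrib, Finset.sum_ite_eq',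
      Finset.mem_univ, if_true]
  have hp'0 : ∀ a i, 0 ≤ p' a i := by
    intro a i
    rw [hp' a i]
    split_ifs
    · exact div_nonneg (sub_nonneg.mpr (hsafe a)) hγ'0.le
    · exact div_nonneg (mul_nonneg hγ0.le (hp0 a i)) hγ'0.le
  have hp'1 : ∀ a, ∑ i, p' a i = 1 := by
    intro a
    have h := hsum a (fun _ => 1)
    simp only [mul_one, hp1] at h
    exact mul_left_cancel₀ hγ'0.ne' (by linarith)
  refine ⟨fun a => ⟨hp'0 a, hp'1 a⟩, fun π _ V V' hV hV' => ?_⟩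
  have hne : 1 - γ' ≠ 0 := by linarith
  obtain ⟨c, hc⟩ : ∃ c, c * (1 - γ') = -(γ - γ') * V s :=
    ⟨-(γ - γ') * V s / (1 - γ'), div_mul_cancel₀ _ hne⟩
  have hshift : ∀ a, γ' * ∑ i, p' a i * (V i + c) = γ * ∑ i, p a i * V i + c := by
    intro a
    rw [hsum a (fun i => V i + c)]
    simp only [mul_add, Finset.sum_add_distrib, ← Finset.sum_mul, hp1]
    linear_combination -hc
  have hVc : V' = fun i => V i + c :=
    eq_of_discounted_eval (fun i => hp'0 (π i)) (fun i => hp'1 (π i)) hγ'0.le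
      (hγ'γ.trans hγ1) hV' (fun i => by rw [hshift (π i)]; linarith [hV i])
  subst hVc
  refine ⟨?_, fun i j => by ring, sp_add_const V c, fun a => ?_⟩
  · rw [eq_div_iff hne]
    linear_combination hc
  · rw [hshift a]
    ring
end

section
/- Consider a finite discounted MDP with exactly two states S = {1, 2}, discount factor γ ∈ (0,1), and a finite action set A with |A| ≥ 3 containing at least one action at each state. Let U be the set of all policies whose actions belong to A, and assume that not all policies in U have the same value vector. Then there exist actions a, b ∈ A with st(a) = st(b) such that for every policy π ∈ U, Adv(b, V^π) > Adv(a, V^π); in particular, a is not efficient on U, i.e., a never maximizes the advantage at its state with respect to any policy in U. -/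
/-- An affine function positive at both ends of an interval is positive on the interval. -/
lemma affine_lt_of_endpoints {r₁ r₂ q₁ q₂ m M d : ℝ} (hm : r₁ + q₁ * m < r₂ + q₂ * m)
    (hM : r₁ + q₁ * M < r₂ + q₂ * M) (hmd : m ≤ d) (hdM : d ≤ M) :
    r₁ + q₁ * d < r₂ + q₂ * d := by
  rcases le_total q₁ q₂ with h | h
  · nlinarith [mul_nonneg (sub_nonneg.2 h) (sub_nonneg.2 hmd)]
  · nlinarith [mul_nonneg (sub_nonneg.2 h) (sub_nonneg.2 hdM)]

/-- An affine map of slope less than one has a unique fixed point. -/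
lemma affine_fixed_unique {c k x y : ℝ} (hk : k < 1) (hx : x = c + k * x) (hy : y = c + k * y) :
    x = y := by
  have h : (1 - k) * (x - y) = 0 := by linear_combination hx - hy
  rcases mul_eq_zero.1 h with h | h <;> linarith

lemma le_affine_of_le_fixed {c k x d : ℝ} (hk : k < 1) (hd : d = c + k * d) (h : x ≤ d) :
    x ≤ c + k * x := by
  nlinarith [mul_nonneg (sub_nonneg.2 hk.le) (sub_nonneg.2 h)]

lemma affine_le_of_fixed_le {c k x d : ℝ} (hk : k < 1) (hd : d = c + k * d) (h : d ≤ x) :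
    c + k * x ≤ x := by
  nlinarith [mul_nonneg (sub_nonneg.2 hk.le) (sub_nonneg.2 h)]

/-- Given two finite families of lines with slopes `q`, consider the fixed points of all the
differences of a line of the second family and a line of the first one.  If they do not all
coincide, then in one of the two families some line lies strictly above another one on an interval
containing all these fixed points. -/
lemma exists_strict_domination {A : Type*} [Fintype A] (st : A → Fin 2)
    (hst : ∀ s : Fin 2, ∃ a, st a = s) (r q : A → ℝ) (hq : ∀ a b, q b - q a < 1) :
    ∃ m M : ℝ, (∀ a b d, st a = 0 → st b = 1 → d = (r b - r a) + (q b - q a) * d →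
        m ≤ d ∧ d ≤ M) ∧
      (m ≠ M → ∃ a b, st a = st b ∧ r a + q a * m < r b + q b * m ∧
        r a + q a * M < r b + q b * M) := by
  classical
  set D : A × A → ℝ := fun x => (r x.2 - r x.1) / (1 - (q x.2 - q x.1))
  have hfix (a b : A) : D (a, b) = (r b - r a) + (q b - q a) * D (a, b) := by
    have : 1 - (q b - q a) ≠ 0 := by linarith [hq a b]
    have h : D (a, b) * (1 - (q b - q a)) = r b - r a := div_mul_cancel₀ _ this
    linear_combination h
  obtain ⟨a₀, ha₀⟩ := hst 0
  obtain ⟨b₀, hb₀⟩ := hst 1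
  set S : Finset (A × A) := Finset.univ.filter fun x => st x.1 = 0 ∧ st x.2 = 1 with hS
  have hmem (a b : A) : (a, b) ∈ S ↔ st a = 0 ∧ st b = 1 := by simp [hS]
  have hne : S.Nonempty := ⟨(a₀, b₀), (hmem _ _).2 ⟨ha₀, hb₀⟩⟩
  obtain ⟨⟨a₁, b₁⟩, h₁, hmin⟩ := S.exists_min_image D hne
  obtain ⟨⟨a₂, b₂⟩, h₂, hmax⟩ := S.exists_max_image D hne
  obtain ⟨ha₁, hb₁⟩ := (hmem _ _).1 h₁
  obtain ⟨ha₂, hb₂⟩ := (hmem _ _).1 h₂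
  have hm := hfix a₁ b₁
  have hM := hfix a₂ b₂
  have hlow (a b : A) (ha : st a = 0) (hb : st b = 1) :=
    le_affine_of_le_fixed (hq a b) (hfix a b) (hmin (a, b) ((hmem _ _).2 ⟨ha, hb⟩))
  have hupp (a b : A) (ha : st a = 0) (hb : st b = 1) :=
    affine_le_of_fixed_le (hq a b) (hfix a b) (hmax (a, b) ((hmem _ _).2 ⟨ha, hb⟩))
  refine ⟨D (a₁, b₁), D (a₂, b₂), fun a b d ha hb hd => ?_, fun hmM => ?_⟩
  · rw [affine_fixed_unique (hq a b) hd (hfix a b)]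
    exact ⟨hmin _ ((hmem _ _).2 ⟨ha, hb⟩), hmax _ ((hmem _ _).2 ⟨ha, hb⟩)⟩
  generalize D (a₁, b₁) = m at *
  generalize D (a₂, b₂) = M at *
  by_contra! hcon
  have hA := hcon a₂ a₁ (ha₂.trans ha₁.symm)
  have hB := hcon b₁ b₂ (hb₁.trans hb₂.symm)
  have unique (a b : A) (x : m = (r b - r a) + (q b - q a) * m)
      (y : M = (r b - r a) + (q b - q a) * M) : False :=
    hmM (affine_fixed_unique (hq a b) x y)
  have l₁ := hlow a₂ b₁ ha₂ hb₁
  have l₂ := hlow a₁ b₂ ha₁ hb₂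
  have u₁ := hupp a₂ b₁ ha₂ hb₁
  have u₂ := hupp a₁ b₂ ha₁ hb₂
  by_cases hA' : r a₂ + q a₂ * m < r a₁ + q a₁ * m <;>
  by_cases hB' : r b₁ + q b₁ * m < r b₂ + q b₂ * m
  · exact unique a₁ b₁ hm (by linarith [hA hA', hB hB'])
  · exact unique a₁ b₂ (by linarith) (by linarith [hA hA'])
  · exact unique a₂ b₁ (by linarith) (by linarith [hB hB'])
  · exact unique a₂ b₂ (by linarith) hM


/-- In a two-state MDP with at least three actions (at least one per state)
in which not all policies share the same value vector, there is an action `a`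
that is strictly dominated at its state by another action `b` with respect to
every policy; in particular `a` is not efficient on the set of all policies. -/
theorem stmt_3 {A : Type} [Fintype A]
    (st : A → Fin 2) (hst : ∀ s : Fin 2, ∃ a, st a = s)
    (p : A → Fin 2 → ℝ) (hp0 : ∀ a i, 0 ≤ p a i) (hp1 : ∀ a, ∑ i, p a i = 1)
    (r : A → ℝ) (γ : ℝ) (hγ0 : 0 < γ) (hγ1 : γ < 1)
    (hcard : 3 ≤ Fintype.card A)
    (hdistinct : ∃ (π₁ π₂ : Fin 2 → A) (V₁ V₂ : Fin 2 → ℝ),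
      (∀ s, st (π₁ s) = s) ∧ (∀ s, st (π₂ s) = s) ∧
      (∀ s, V₁ s = r (π₁ s) + γ * ∑ i, p (π₁ s) i * V₁ i) ∧
      (∀ s, V₂ s = r (π₂ s) + γ * ∑ i, p (π₂ s) i * V₂ i) ∧ V₁ ≠ V₂) :
    ∃ a b : A, st a = st b ∧
      (∀ (π : Fin 2 → A) (V : Fin 2 → ℝ), (∀ s, st (π s) = s) →
        (∀ s, V s = r (π s) + γ * ∑ i, p (π s) i * V i) →
        r a + γ * ∑ i, p a i * V i - V (st a) <
          r b + γ * ∑ i, p b i * V i - V (st b)) ∧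
      (∀ (π : Fin 2 → A) (V : Fin 2 → ℝ), (∀ s, st (π s) = s) →
        (∀ s, V s = r (π s) + γ * ∑ i, p (π s) i * V i) →
        ¬ (∀ a', st a' = st a →
            r a' + γ * ∑ i, p a' i * V i - V (st a') ≤
              r a + γ * ∑ i, p a i * V i - V (st a))) := by
  have hp (a : A) : p a 0 = 1 - p a 1 := by
    have := hp1 a
    rw [Fin.sum_univ_two] at this
    linarith
  have hq (a b : A) : γ * p b 1 - γ * p a 1 < 1 := by
    nlinarith [hp b, hp0 b 0, hp0 a 1, mul_nonneg hγ0.le (hp0 b 0), mul_nonneg hγ0.le (hp0 a 1)]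
  have hsum (a : A) (V : Fin 2 → ℝ) :
      r a + γ * ∑ i, p a i * V i = r a + γ * p a 1 * (V 1 - V 0) + γ * V 0 := by
    rw [Fin.sum_univ_two, hp a]
    ring
  have hdiff (π : Fin 2 → A) (V : Fin 2 → ℝ)
      (hV : ∀ s, V s = r (π s) + γ * ∑ i, p (π s) i * V i) :
      V 1 - V 0 = (r (π 1) - r (π 0)) + (γ * p (π 1) 1 - γ * p (π 0) 1) * (V 1 - V 0) := by
    linear_combination (hV 1).trans (hsum _ V) - (hV 0).trans (hsum _ V)
  obtain ⟨m, M, hbound, hdom⟩ :=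
    exists_strict_domination st hst r (fun a => γ * p a 1) (fun a b => hq a b)
  obtain ⟨a, b, hab, hm, hM⟩ : ∃ a b, st a = st b ∧ r a + γ * p a 1 * m < r b + γ * p b 1 * m ∧
      r a + γ * p a 1 * M < r b + γ * p b 1 * M := by
    by_cases hmM : m = M
    · subst hmM
      obtain ⟨π₁, π₂, V₁, V₂, h₁, h₂, hV₁, hV₂, hne⟩ := hdistinct
      have e₁ : V₁ 1 - V₁ 0 = m :=
        have h := hbound _ _ _ (h₁ 0) (h₁ 1) (hdiff π₁ V₁ hV₁)
        le_antisymm h.2 h.1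
      have e₂ : V₂ 1 - V₂ 0 = m :=
        have h := hbound _ _ _ (h₂ 0) (h₂ 1) (hdiff π₂ V₂ hV₂)
        le_antisymm h.2 h.1
      have v₁ := (hV₁ 0).trans (hsum _ V₁)
      have v₂ := (hV₂ 0).trans (hsum _ V₂)
      rw [e₁] at v₁
      rw [e₂] at v₂
      rcases lt_trichotomy (r (π₁ 0) + γ * p (π₁ 0) 1 * m) (r (π₂ 0) + γ * p (π₂ 0) 1 * m)
        with h | h | h
      · exact ⟨_, _, (h₁ 0).trans (h₂ 0).symm, h, h⟩
      · have h0 : V₁ 0 = V₂ 0 := affine_fixed_unique hγ1 v₁ (h ▸ v₂)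
        refine absurd (funext fun s => ?_) hne
        fin_cases s
        · exact h0
        · change V₁ 1 = V₂ 1
          linarith
      · exact ⟨_, _, (h₂ 0).trans (h₁ 0).symm, h, h⟩
    · exact hdom hmM
  have key (π : Fin 2 → A) (V : Fin 2 → ℝ) (hπ : ∀ s, st (π s) = s)
      (hV : ∀ s, V s = r (π s) + γ * ∑ i, p (π s) i * V i) :
      r a + γ * ∑ i, p a i * V i - V (st a) < r b + γ * ∑ i, p b i * V i - V (st b) := by
    have h := hbound _ _ _ (hπ 0) (hπ 1) (hdiff π V hV)
    rw [hsum, hsum, hab]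
    linarith [affine_lt_of_endpoints hm hM h.1 h.2]
  exact ⟨a, b, hab, key, fun π V hπ hV h => (key π V hπ hV).not_ge (h b hab.symm)⟩
end

section
/- Consider a finite discounted MDP with exactly two states S = {1, 2}, discount factor γ ∈ (0,1), and a finite action set A with at least one action at each state. Assume that distinct policies have distinct value vectors. Let (π_t)_{t≥0} be any Policy Iteration sequence: π_0 is an arbitrary policy with actions in A, and for every t and state s, π_{t+1}(s) is an action of A at s that maximizes Adv(·, V^{π_t}) among actions of A at s. Then π_t is an optimal policy for all t ≥ |A|: that is, V^{π_t}(s) ≥ V^{π}(s) for every policy π and every state s whenever t ≥ |A|. -/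
/-- On two states, the expectation of `V` is affine in the gap `V 1 - V 0`. -/
lemma sum_mul_eq_add_gap (q V : Fin 2 → ℝ) (hq : ∑ i, q i = 1) :
    ∑ i, q i * V i = V 0 + q 1 * (V 1 - V 0) := by
  rw [Fin.sum_univ_two] at hq ⊢
  linear_combination V 0 * hq

/-- A function dominating `γ` times its own average under a stochastic matrix is nonnegative. -/
lemma nonneg_of_discounted_average_le {S : Type*} [Fintype S] [Nonempty S]
    (P : S → S → ℝ) (hP0 : ∀ s i, 0 ≤ P s i) (hP1 : ∀ s, ∑ i, P s i = 1)
    {γ : ℝ} (hγ0 : 0 ≤ γ) (hγ1 : γ < 1) (D : S → ℝ)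
    (hD : ∀ s, γ * ∑ i, P s i * D i ≤ D s) (s : S) : 0 ≤ D s := by
  obtain ⟨m, hm⟩ := Finite.exists_min D
  have hsum : D m ≤ ∑ i, P m i * D i := by
    calc D m = ∑ i, P m i * D m := by rw [← Finset.sum_mul, hP1, one_mul]
      _ ≤ ∑ i, P m i * D i :=
        Finset.sum_le_sum fun i _ => mul_le_mul_of_nonneg_left (hm i) (hP0 m i)
  have hmm : γ * D m ≤ D m := (mul_le_mul_of_nonneg_left hsum hγ0).trans (hD m)
  have : 0 ≤ D m := by nlinarith
  exact this.trans (hm s)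

/-- If `W` is at most its one-step backup and `V` at least its own, then `W ≤ V`. -/
lemma le_of_le_backup_of_backup_le {S : Type*} [Fintype S] [Nonempty S]
    (P : S → S → ℝ) (hP0 : ∀ s i, 0 ≤ P s i) (hP1 : ∀ s, ∑ i, P s i = 1)
    {γ : ℝ} (hγ0 : 0 ≤ γ) (hγ1 : γ < 1) (ρ V W : S → ℝ)
    (hW : ∀ s, W s ≤ ρ s + γ * ∑ i, P s i * W i)
    (hV : ∀ s, ρ s + γ * ∑ i, P s i * V i ≤ V s) : W ≤ V := by
  intro s
  have := nonneg_of_discounted_average_le P hP0 hP1 hγ0 hγ1 (fun i => V i - W i) (fun s => by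
    have h : ∑ i, P s i * (V i - W i) = ∑ i, P s i * V i - ∑ i, P s i * W i := by
      rw [← Finset.sum_sub_distrib]
      exact Finset.sum_congr rfl fun i _ => mul_sub _ _ _
    rw [h, mul_sub]
    linarith [hW s, hV s]) s
  simpa using this


/-- In a two-state MDP in which distinct policies have distinct value vectors,
any Policy Iteration sequence reaches an optimal policy after at most `|A|`
iterations: `π_t` is optimal for all `t ≥ |A|`. -/
theorem stmt_4 {A : Type} [Fintype A]
    (st : A → Fin 2) (hst : ∀ s : Fin 2, ∃ a, st a = s)
    (p : A → Fin 2 → ℝ) (hp0 : ∀ a i, 0 ≤ p a i) (hp1 : ∀ a, ∑ i, p a i = 1)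
    (r : A → ℝ) (γ : ℝ) (hγ0 : 0 < γ) (hγ1 : γ < 1)
    (Val : (Fin 2 → A) → Fin 2 → ℝ)
    (hVal : ∀ π : Fin 2 → A, (∀ s, st (π s) = s) →
      ∀ s, Val π s = r (π s) + γ * ∑ i, p (π s) i * Val π i)
    (hdistinct : ∀ π π' : Fin 2 → A, (∀ s, st (π s) = s) → (∀ s, st (π' s) = s) →
      π ≠ π' → Val π ≠ Val π')
    (πseq : ℕ → Fin 2 → A)
    (hπ0 : ∀ s, st (πseq 0 s) = s)
    (hstep : ∀ t s, st (πseq (t + 1) s) = s ∧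
      ∀ a, st a = s →
        r a + γ * ∑ i, p a i * Val (πseq t) i - Val (πseq t) s ≤
          r (πseq (t + 1) s) + γ * ∑ i, p (πseq (t + 1) s) i * Val (πseq t) i -
            Val (πseq t) s) :
    ∀ t, Fintype.card A ≤ t →
      ∀ π : Fin 2 → A, (∀ s, st (π s) = s) → ∀ s, Val π s ≤ Val (πseq t) s := by
  classical
  -- `Q a V` is the one-step backup of `V` through `a`.
  set Q : A → (Fin 2 → ℝ) → ℝ := fun a V => r a + γ * ∑ i, p a i * V i with hQ
  have hQgap (a V) : Q a V = r a + γ * (V 0 + p a 1 * (V 1 - V 0)) := by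
    simp only [hQ, sum_mul_eq_add_gap _ _ (hp1 a)]
  have compare (π : Fin 2 → A) (V W : Fin 2 → ℝ) (hW : ∀ s, W s ≤ Q (π s) W)
      (hV : ∀ s, Q (π s) V ≤ V s) : W ≤ V :=
    le_of_le_backup_of_backup_le (fun s => p (π s)) (fun s => hp0 (π s)) (fun s => hp1 (π s))
      hγ0.le hγ1 (fun s => r (π s)) V W hW hV
  have hpol : ∀ t s, st (πseq t s) = s
    | 0, s => hπ0 s
    | t + 1, s => (hstep t s).1
  have hfix (t s) : Val (πseq t) s = Q (πseq t s) (Val (πseq t)) := hVal _ (hpol t) s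
  have hgreedy (t s a) (ha : st a = s) :
      Q a (Val (πseq t)) ≤ Q (πseq (t + 1) s) (Val (πseq t)) := by
    have := (hstep t s).2 a ha
    simp only [hQ]
    linarith
  have hmono : Monotone fun t => Val (πseq t) := monotone_nat_of_le_succ fun t =>
    compare (πseq (t + 1)) _ _
      (fun s => (hfix t s).le.trans (hgreedy t s _ (hpol t s))) (fun s => (hfix (t + 1) s).ge)
  intro t ht
  by_contra hnot
  -- No value vector up to time `t` solves the optimality inequalities.
  have hnopt (j) (hj : j ≤ t) : ¬ ∀ s a, st a = s → Q a (Val (πseq j)) ≤ Val (πseq j) s :=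
    fun h => hnot fun π hπ s =>
      (compare π (Val (πseq j)) (Val π) (fun s => (hVal π hπ s).le)
        (fun s => h s _ (hπ s)) s).trans (hmono hj s)
  have hgap (i j) (hij : i < j) (hj : j ≤ t) :
      Val (πseq i) 1 - Val (πseq i) 0 ≠ Val (πseq j) 1 - Val (πseq j) 0 := by
    intro hd
    have hg (s a) (ha : st a = s) :
        Q a (Val (πseq j)) ≤ Q (πseq (i + 1) s) (Val (πseq j)) := by
      have := hgreedy i s a ha
      rw [hQgap, hQgap, hd] at this
      rw [hQgap, hQgap]
      linarith
    have hle : Val (πseq j) ≤ Val (πseq (i + 1)) :=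
      compare (πseq (i + 1)) _ _ (fun s => (hfix j s).le.trans (hg s _ (hpol j s)))
        (fun s => (hfix (i + 1) s).ge)
    have heq : Val (πseq j) = Val (πseq (i + 1)) := le_antisymm hle (hmono hij)
    refine hnopt j hj fun s a ha => (hg s a ha).trans ?_
    rw [heq]
    exact (hfix (i + 1) s).ge
  have hne (i j) (hij : i < j) (hj : j < t) : πseq (i + 1) ≠ πseq (j + 1) := by
    intro h
    have heq : Val (πseq (i + 1)) = Val (πseq (i + 2)) := by
      refine le_antisymm (hmono (by omega)) ?_
      rw [h]
      exact hmono (by omega)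
    refine hnopt (i + 1) (by omega) fun s a ha => (hgreedy (i + 1) s a ha).trans ?_
    rw [heq]
    exact (hfix (i + 2) s).ge
  have hne' (i j) (hij : i ≠ j) (hi : i < t) (hj : j < t) : πseq (i + 1) ≠ πseq (j + 1) := by
    rcases hij.lt_or_gt with h | h
    · exact hne i j h hj
    · exact (hne j i h hi).symm
  -- Distinctness of value vectors rules out duplicate actions.
  have hdup (k s a) (ha : st a = s) (hr : r a = r (πseq k s)) (hp : p a 1 = p (πseq k s) 1) :
      a = πseq k s := by
    by_contra hna
    set π := Function.update (πseq k) s a with hπ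
    have hπst : ∀ u, st (π u) = u := by
      intro u
      by_cases hu : u = s
      · subst hu; simpa [hπ] using ha
      · simpa [hπ, hu] using hpol k u
    have hQeq (u V) : Q (π u) V = Q (πseq k u) V := by
      by_cases hu : u = s
      · subst hu; simp only [hπ, Function.update_self, hQgap, hr, hp]
      · simp [hπ, hu]
    refine hdistinct π (πseq k) hπst (hpol k) (fun h => hna ?_) ?_
    · rw [← h, hπ, Function.update_self]
    · have hself (u) : Val π u = Q (π u) (Val π) := hVal π hπst u
      exact le_antisymm
        (compare π _ _ (fun u => (hself u).le) (fun u => by rw [hQeq]; exact (hfix k u).ge))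
        (compare π _ _ (fun u => by rw [hQeq]; exact (hfix k u).le) (fun u => (hself u).ge))
  let U : ℕ → Finset A := fun i =>
    Finset.univ.filter fun c => p c 1 < p (πseq (i + 1) (st c)) 1
  have hU (i j) (hij : i ≠ j) (hi : i < t) (hj : j < t)
      (hd : Val (πseq i) 1 - Val (πseq i) 0 < Val (πseq j) 1 - Val (πseq j) 0) :
      U i ⊂ U j := by
    have hcmp (s) : r (πseq (j + 1) s) + γ * (p (πseq (j + 1) s) 1 *
          (Val (πseq i) 1 - Val (πseq i) 0)) ≤
        r (πseq (i + 1) s) + γ * (p (πseq (i + 1) s) 1 * (Val (πseq i) 1 - Val (πseq i) 0)) ∧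
        r (πseq (i + 1) s) + γ * (p (πseq (i + 1) s) 1 * (Val (πseq j) 1 - Val (πseq j) 0)) ≤
        r (πseq (j + 1) s) + γ * (p (πseq (j + 1) s) 1 *
          (Val (πseq j) 1 - Val (πseq j) 0)) := by
      have h1 := hgreedy i s _ (hpol (j + 1) s)
      have h2 := hgreedy j s _ (hpol (i + 1) s)
      rw [hQgap, hQgap] at h1 h2
      constructor <;> linarith
    have hle (s) : p (πseq (i + 1) s) 1 ≤ p (πseq (j + 1) s) 1 := by
      obtain ⟨h1, h2⟩ := hcmp s
      by_contra! hlt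
      nlinarith [mul_pos hγ0 (mul_pos (sub_pos.2 hlt) (sub_pos.2 hd))]
    obtain ⟨s, hs⟩ := Function.ne_iff.1 (hne' i j hij hi hj)
    have hlt : p (πseq (i + 1) s) 1 < p (πseq (j + 1) s) 1 := by
      refine (hle s).lt_of_ne fun h => hs (hdup (j + 1) s _ (hpol _ s) ?_ h)
      obtain ⟨h1, h2⟩ := hcmp s
      rw [h] at h1 h2
      linarith
    refine Finset.ssubset_iff_of_subset (fun c hc => ?_) |>.2 ⟨πseq (i + 1) s, ?_, ?_⟩
    · simp only [U, Finset.mem_filter, Finset.mem_univ, true_and] at hc ⊢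
      exact hc.trans_le (hle _)
    · simpa [U, hpol] using hlt
    · simp [U, hpol]
  have hcard (i) : (U i).card + 1 < Fintype.card A := by
    have h01 : πseq (i + 1) 0 ≠ πseq (i + 1) 1 := fun h => by
      simpa [hpol] using congrArg st h
    have hdisj : Disjoint (U i) {πseq (i + 1) 0, πseq (i + 1) 1} := by
      simp [U, hpol]
    have := Finset.card_le_univ (U i ∪ {πseq (i + 1) 0, πseq (i + 1) 1})
    rw [Finset.card_union_of_disjoint hdisj, Finset.card_pair h01] at this
    omega
  obtain ⟨i, hi, j, hj, hij, heq⟩ := Finset.exists_ne_map_eq_of_card_lt_of_maps_to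
    (s := Finset.range t) (t := Finset.range (Fintype.card A - 1)) (f := fun i => (U i).card)
    (by have := hcard 0; simp only [Finset.card_range]; omega)
    (fun i _ => by have := hcard i; simp only [Finset.coe_range, Set.mem_Iio]; omega)
  rw [Finset.mem_range] at hi hj
  have hdne : Val (πseq i) 1 - Val (πseq i) 0 ≠ Val (πseq j) 1 - Val (πseq j) 0 := by
    rcases hij.lt_or_gt with h | h
    · exact hgap i j h hj.le
    · exact (hgap j i h hi.le).symm
  rcases hdne.lt_or_gt with h | h
  · exact (Finset.card_lt_card (hU i j hij hi hj h)).ne heq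
  · exact (Finset.card_lt_card (hU j i hij.symm hj hi h)).ne heq.symm
end

section
/- Consider a finite discounted MDP that is normalized with optimal policy π* and advantage gap δ > 0: r^{π*(s)} = 0 for all states s, and r^a ≤ −δ for every action a not in the range of π*. Let V : S → ℝ have sp(V) > 0, let s be a state, and suppose some action a at s with a ≠ π*(s) attains the maximum in (TV)(s) = max_{a': st(a')=s} ( r^{a'} + γ Σ_i p^{a'}_i V(i) ). Then: (i) δ ≤ γ·sp(V); and (ii) there exists d with δ/(γ·sp(V)) ≤ d ≤ 1 such that (TV)(s) = γ·( d · Σ_i p^{π*(s)}_i V(i) + (1−d) · Σ_i p^a_i V(i) ). -/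
/-- An average of `V` is at most its maximum. -/
theorem weightedSum_le_sup' {S : Type} [Fintype S] [Nonempty S] (V q : S → ℝ)
    (hq0 : ∀ i, 0 ≤ q i) (hq1 : ∑ i, q i = 1) :
    ∑ i, q i * V i ≤ Finset.univ.sup' Finset.univ_nonempty V := by
  calc ∑ i, q i * V i
      ≤ ∑ i, q i * Finset.univ.sup' Finset.univ_nonempty V := by
        gcongr with i
        · exact hq0 i
        · exact Finset.le_sup' V (Finset.mem_univ i)
    _ = _ := by rw [← Finset.sum_mul, hq1, one_mul]

/-- An average of `V` is at least its minimum. -/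
theorem inf'_le_weightedSum {S : Type} [Fintype S] [Nonempty S] (V q : S → ℝ)
    (hq0 : ∀ i, 0 ≤ q i) (hq1 : ∑ i, q i = 1) :
    Finset.univ.inf' Finset.univ_nonempty V ≤ ∑ i, q i * V i := by
  calc _ = ∑ i, q i * Finset.univ.inf' Finset.univ_nonempty V := by
        rw [← Finset.sum_mul, hq1, one_mul]
    _ ≤ ∑ i, q i * V i := by
        gcongr with i
        · exact hq0 i
        · exact Finset.inf'_le V (Finset.mem_univ i)

/-- Two averages of `V` differ by at most its span. -/
theorem weightedSum_sub_weightedSum_le_sp {S : Type} [Fintype S] [Nonempty S] (V q q' : S → ℝ)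
    (hq0 : ∀ i, 0 ≤ q i) (hq1 : ∑ i, q i = 1) (hq0' : ∀ i, 0 ≤ q' i) (hq1' : ∑ i, q' i = 1) :
    ∑ i, q i * V i - ∑ i, q' i * V i ≤ sp V :=
  sub_le_sub (weightedSum_le_sup' V q hq0 hq1) (inf'_le_weightedSum V q' hq0' hq1')

/-- In a normalized MDP with advantage gap `δ > 0`, if a non-optimal action `a`
attains the Bellman maximum at its state `s`, then `δ ≤ γ·sp(V)` and the update
`(TV)(s) = r^a + γ ∑ i p^a_i V i` is a convex combination
`γ (d ∑ i p^{π*(s)}_i V i + (1-d) ∑ i p^a_i V i)` with `δ/(γ·sp V) ≤ d ≤ 1`. -/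
theorem stmt_6 {S A : Type} [Fintype S] [Nonempty S] [Fintype A]
    (st : A → S) (hst : ∀ s : S, ∃ a, st a = s)
    (p : A → S → ℝ) (hp0 : ∀ a i, 0 ≤ p a i) (hp1 : ∀ a, ∑ i, p a i = 1)
    (r : A → ℝ) (γ : ℝ) (hγ0 : 0 < γ) (hγ1 : γ < 1)
    (πstar : S → A) (hπstar : ∀ s, st (πstar s) = s)
    (hr0 : ∀ s, r (πstar s) = 0) (hrle : ∀ a, r a ≤ 0)
    (δ : ℝ) (hδ : 0 < δ) (hgap : ∀ a, a ∉ Set.range πstar → r a ≤ -δ)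
    (V : S → ℝ) (hspV : 0 < sp V)
    (s : S) (a : A) (has : st a = s) (hane : a ≠ πstar s)
    (hmax : ∀ a', st a' = s →
      r a' + γ * ∑ i, p a' i * V i ≤ r a + γ * ∑ i, p a i * V i) :
    δ ≤ γ * sp V ∧
    ∃ d : ℝ, δ / (γ * sp V) ≤ d ∧ d ≤ 1 ∧
      r a + γ * ∑ i, p a i * V i =
        γ * (d * ∑ i, p (πstar s) i * V i + (1 - d) * ∑ i, p a i * V i) := by
  have ha : a ∉ Set.range πstar := by
    rintro ⟨t, rfl⟩
    exact hane (congrArg πstar ((hπstar t).symm.trans has))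
  have hra := hgap a ha
  have hopt := hmax (πstar s) (hπstar s)
  rw [hr0] at hopt
  have hD := weightedSum_sub_weightedSum_le_sp V (p a) (p (πstar s)) (hp0 _) (hp1 _) (hp0 _) (hp1 _)
  generalize ∑ i, p a i * V i = x at *
  generalize ∑ i, p (πstar s) i * V i = y at *
  have hle : γ * (x - y) ≤ γ * sp V := mul_le_mul_of_nonneg_left hD hγ0.le
  have hge : -r a ≤ γ * (x - y) := by linarith
  have hpos : 0 < γ * (x - y) := by linarith
  refine ⟨by linarith, -r a / (γ * (x - y)), ?_, (div_le_one hpos).2 hge, ?_⟩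
  · exact div_le_div₀ (by linarith) (by linarith) hpos hle
  · have h : -r a / (γ * (x - y)) * (γ * (x - y)) = -r a := div_mul_cancel₀ _ hpos.ne'
    linear_combination h
end

section
/- Consider a finite discounted MDP with n states, normalized with optimal policy π* and advantage gap δ > 0 (r^{π*(s)} = 0 for all s, and r^a ≤ −δ for all actions a not in the range of π*). Let P* be the n×n stochastic matrix with rows p^{π*(s)}, and suppose there are N ≥ 1 and ω > 0 such that every entry of (P*)^N is at least ω. Let V_0 : S → ℝ and define V_{t+1} = T V_t (synchronous Value Iteration). Assume sp(V_t) > 0 and δ ≤ γ·sp(V_t) for all t = 0, 1, …, N−1. Then sp(V_N) ≤ γ^N · ( 1 − n·ω·δ^N / ( γ^N · Π_{t=0}^{N−1} sp(V_t) ) ) · sp(V_0), and the factor 1 − n·ω·δ^N / ( γ^N · Π_{t=0}^{N−1} sp(V_t) ) lies in [0, 1). -/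
/-- A finite discounted MDP: states `S`, actions `A`, each action `a` available
at state `st a`, with transition probability vector `p a`, reward `r a`, and
discount factor `γ ∈ (0,1)`. -/
structure FMDP (S A : Type) [Fintype S] [Fintype A] where
  st : A → S
  st_surj : ∀ s : S, ∃ a, st a = s
  p : A → S → ℝ
  p_nonneg : ∀ a i, 0 ≤ p a i
  p_sum : ∀ a, ∑ i, p a i = 1
  r : A → ℝ
  γ : ℝ
  γ_pos : 0 < γ
  γ_lt_one : γ < 1

/-- The Bellman optimality operator `(TV)(s) = max_{a : st a = s} (r a + γ ∑ i, p a i * V i)`. -/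
noncomputable def FMDP.T {S A : Type} [Fintype S] [Fintype A] [DecidableEq S]
    (M : FMDP S A) (V : S → ℝ) (s : S) : ℝ :=
  (Finset.univ.filter fun a => M.st a = s).sup'
    (by obtain ⟨a, ha⟩ := M.st_surj s; exact ⟨a, by simp [ha]⟩)
    (fun a => M.r a + M.γ * ∑ i, M.p a i * V i)

section Span

variable {S : Type} [Fintype S] [Nonempty S]

theorem sub_le_sp (V : S → ℝ) (i j : S) : V i - V j ≤ sp V :=
  sub_le_sub (Finset.le_sup' V (Finset.mem_univ i)) (Finset.inf'_le V (Finset.mem_univ j))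

theorem sp_le {V : S → ℝ} {x : ℝ} (h : ∀ i j, V i - V j ≤ x) : sp V ≤ x := by
  obtain ⟨i, -, hi⟩ := Finset.exists_mem_eq_sup' Finset.univ_nonempty V
  obtain ⟨j, -, hj⟩ := Finset.exists_mem_eq_inf' Finset.univ_nonempty V
  rw [sp, hi, hj]
  exact h i j

/-- The averages of `V` under two probability vectors differ by at most its span. -/
theorem sum_mul_sub_sum_mul_le_sp {p q : S → ℝ} (hp : ∀ i, 0 ≤ p i) (hp1 : ∑ i, p i = 1)
    (hq : ∀ i, 0 ≤ q i) (hq1 : ∑ i, q i = 1) (V : S → ℝ) :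
    ∑ i, p i * V i - ∑ i, q i * V i ≤ sp V := by
  obtain ⟨j, -, hj⟩ := Finset.exists_mem_eq_inf' Finset.univ_nonempty V
  have h1 : ∑ i, p i * V i ≤ ∑ i, p i * (V j + sp V) :=
    Finset.sum_le_sum fun i _ =>
      mul_le_mul_of_nonneg_left (by linarith [sub_le_sp V i j]) (hp i)
  have h2 : ∑ i, q i * V j ≤ ∑ i, q i * V i :=
    Finset.sum_le_sum fun i _ =>
      mul_le_mul_of_nonneg_left (hj ▸ Finset.inf'_le V (Finset.mem_univ i)) (hq i)
  rw [← Finset.sum_mul, hp1] at h1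
  rw [← Finset.sum_mul, hq1] at h2
  linarith

end Span

section Stochastic

variable {S : Type} [Fintype S]

theorem pow_mulVec_const [DecidableEq S] {P : Matrix S S ℝ} (hP : ∀ s, ∑ i, P s i = 1) (c : ℝ) (t : ℕ) :
    (P ^ t).mulVec (fun _ => c) = fun _ => c := by
  induction t with
  | zero => simp
  | succ t ih =>
    rw [pow_succ', ← Matrix.mulVec_mulVec, ih]
    ext s
    simp [Matrix.mulVec, dotProduct, ← Finset.sum_mul, hP]

theorem mul_sum_le_mulVec {Q : Matrix S S ℝ} {ω : ℝ} (hQ : ∀ i j, ω ≤ Q i j) {g : S → ℝ}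
    (hg : ∀ i, 0 ≤ g i) (s : S) : ω * ∑ i, g i ≤ Q.mulVec g s := by
  rw [Finset.mul_sum]
  exact Finset.sum_le_sum fun i _ => mul_le_mul_of_nonneg_right (hQ s i) (hg i)

theorem mulVec_le_of_entry_ge {Q : Matrix S S ℝ} {ω D : ℝ} (hQ : ∀ i j, ω ≤ Q i j)
    (hQ1 : ∀ s, ∑ i, Q s i = 1) {g : S → ℝ} (hg : ∀ i, g i ≤ D) (s : S) :
    Q.mulVec g s ≤ ω * ∑ i, g i + (1 - Fintype.card S * ω) * D := by
  have h : ∑ i, (Q s i - ω) * g i ≤ ∑ i, (Q s i - ω) * D :=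
    Finset.sum_le_sum fun i _ => mul_le_mul_of_nonneg_left (hg i) (sub_nonneg.2 (hQ s i))
  rw [← Finset.sum_mul, Finset.sum_sub_distrib, hQ1] at h
  simp only [sub_mul, Finset.sum_sub_distrib, ← Finset.mul_sum, Finset.sum_const,
    Finset.card_univ, nsmul_eq_mul] at h
  simp only [Matrix.mulVec, dotProduct]
  linarith

end Stochastic

namespace FMDP

variable {S A : Type} [Fintype S] [Fintype A] (M : FMDP S A)

theorem sum_p_mul_const_sub (a : A) (c : ℝ) (V : S → ℝ) :
    ∑ i, M.p a i * (c - V i) = c - ∑ i, M.p a i * V i := by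
  simp only [mul_sub, Finset.sum_sub_distrib, ← Finset.sum_mul, M.p_sum, one_mul]

variable [DecidableEq S]

theorem le_T (V : S → ℝ) {a : A} {s : S} (ha : M.st a = s) :
    M.r a + M.γ * ∑ i, M.p a i * V i ≤ M.T V s :=
  Finset.le_sup' (fun a => M.r a + M.γ * ∑ i, M.p a i * V i) (by simp [ha])

theorem exists_T_eq (V : S → ℝ) (s : S) :
    ∃ a, M.st a = s ∧ M.T V s = M.r a + M.γ * ∑ i, M.p a i * V i := by
  obtain ⟨a, ha, h⟩ := Finset.exists_mem_eq_sup' (s := Finset.univ.filter fun a => M.st a = s)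
    (by obtain ⟨a, ha⟩ := M.st_surj s; exact ⟨a, by simp [ha]⟩)
    (fun a => M.r a + M.γ * ∑ i, M.p a i * V i)
  exact ⟨a, by simpa using ha, h⟩

variable {M} {π : S → A} {V : ℕ → S → ℝ}

theorem pow_mul_pow_mulVec_le (hπ : ∀ s, M.st (π s) = s) (hr0 : ∀ s, M.r (π s) = 0)
    (hVI : ∀ t, V (t + 1) = M.T (V t)) (t : ℕ) (s : S) :
    M.γ ^ t * ((Matrix.of fun s i => M.p (π s) i) ^ t).mulVec (V 0) s ≤ V t s := by
  induction t generalizing s with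
  | zero => simp
  | succ t ih =>
    have hT := M.le_T (V t) (hπ s)
    rw [hr0, zero_add, ← hVI] at hT
    refine le_trans ?_ hT
    rw [pow_succ', pow_succ', ← Matrix.mulVec_mulVec, mul_assoc]
    refine mul_le_mul_of_nonneg_left ?_ M.γ_pos.le
    rw [Matrix.mulVec, dotProduct, Finset.mul_sum]
    refine Finset.sum_le_sum fun i _ => ?_
    rw [mul_left_comm]
    exact mul_le_mul_of_nonneg_left (ih i) (M.p_nonneg _ _)

theorem le_pow_mul (hrle : ∀ a, M.r a ≤ 0) (hVI : ∀ t, V (t + 1) = M.T (V t)) {B : ℝ}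
    (hB : ∀ s, V 0 s ≤ B) (t : ℕ) (s : S) : V t s ≤ M.γ ^ t * B := by
  induction t generalizing s with
  | zero => simpa using hB s
  | succ t ih =>
    obtain ⟨a, -, ha⟩ := M.exists_T_eq (V t) s
    have h : ∑ i, M.p a i * V t i ≤ ∑ i, M.p a i * (M.γ ^ t * B) :=
      Finset.sum_le_sum fun i _ => mul_le_mul_of_nonneg_left (ih i) (M.p_nonneg a i)
    rw [← Finset.sum_mul, M.p_sum, one_mul] at h
    rw [hVI, ha, pow_succ', mul_assoc]
    linarith [hrle a, mul_le_mul_of_nonneg_left h M.γ_pos.le]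

/-- The gap between `γ ^ t * B` and the iterate `V t` dominates a damped version of the
averages of the initial gap under the powers of the optimal transition matrix. -/
theorem prod_mul_pow_mulVec_le [Nonempty S] (hπ : ∀ s, M.st (π s) = s) (hr0 : ∀ s, M.r (π s) = 0)
    (hrle : ∀ a, M.r a ≤ 0) {δ : ℝ} (hδ : 0 < δ) (hgap : ∀ a, a ∉ Set.range π → M.r a ≤ -δ)
    (hVI : ∀ t, V (t + 1) = M.T (V t)) {B : ℝ} (hB : ∀ s, V 0 s ≤ B) {N : ℕ}
    (hsp : ∀ t < N, 0 < sp (V t)) (hδγ : ∀ t < N, δ ≤ M.γ * sp (V t))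
    (t : ℕ) (ht : t ≤ N) (s : S) :
    (∏ k ∈ Finset.range t, δ / sp (V k)) *
        ((Matrix.of fun s i => M.p (π s) i) ^ t).mulVec (fun i => B - V 0 i) s ≤
      M.γ ^ t * B - V t s := by
  induction t generalizing s with
  | zero => simp
  | succ t ih =>
    have htN : t < N := ht
    have hσ := hsp t htN
    have hc : 0 ≤ δ / sp (V t) := by positivity
    have hcγ : δ / sp (V t) ≤ M.γ := (div_le_iff₀ hσ).2 (hδγ t htN)
    have hcσ : δ / sp (V t) * sp (V t) = δ := div_mul_cancel₀ _ hσ.ne'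
    have hg : ∀ i, 0 ≤ M.γ ^ t * B - V t i := fun i => sub_nonneg.2 (le_pow_mul hrle hVI hB t i)
    have hpg : ∀ a, 0 ≤ M.γ ^ t * B - ∑ i, M.p a i * V t i := fun a => by
      rw [← M.sum_p_mul_const_sub]
      exact Finset.sum_nonneg fun i _ => mul_nonneg (M.p_nonneg a i) (hg i)
    have hstep : δ / sp (V t) * (M.γ ^ t * B - ∑ i, M.p (π s) i * V t i) ≤
        M.γ ^ (t + 1) * B - V (t + 1) s := by
      obtain ⟨a, has, ha⟩ := M.exists_T_eq (V t) s
      rw [hVI, ha, pow_succ']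
      by_cases hmem : a ∈ Set.range π
      · obtain ⟨s', rfl⟩ := hmem
        rw [hπ] at has
        subst has
        linarith [mul_le_mul_of_nonneg_right hcγ (hpg (π s')), hr0 s']
      · have hdiff := sum_mul_sub_sum_mul_le_sp (M.p_nonneg a) (M.p_sum a)
          (M.p_nonneg (π s)) (M.p_sum (π s)) (V t)
        linarith [mul_le_mul_of_nonneg_right hcγ (hpg a), hgap a hmem,
          mul_le_mul_of_nonneg_left hdiff hc]
    refine le_trans ?_ hstep
    rw [Finset.prod_range_succ, pow_succ', ← Matrix.mulVec_mulVec, mul_comm (∏ _ ∈ _, _), mul_assoc]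
    refine mul_le_mul_of_nonneg_left ?_ hc
    rw [← M.sum_p_mul_const_sub, Matrix.mulVec, dotProduct, Finset.mul_sum]
    refine Finset.sum_le_sum fun i _ => ?_
    rw [mul_left_comm]
    exact mul_le_mul_of_nonneg_left (ih htN.le i) (M.p_nonneg _ _)

end FMDP

/-- Span contraction of synchronous Value Iteration in a normalized MDP with
advantage gap `δ`, when every entry of `(P*)^N` is at least `ω`:
`sp(V_N) ≤ γ^N (1 - n ω δ^N / (γ^N ∏_{t<N} sp(V_t))) sp(V_0)`, and the extra
factor lies in `[0,1)`. -/
theorem stmt_7 {S A : Type} [Fintype S] [Nonempty S] [DecidableEq S] [Fintype A]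
    (M : FMDP S A)
    (πstar : S → A) (hπstar : ∀ s, M.st (πstar s) = s)
    (hr0 : ∀ s, M.r (πstar s) = 0) (hrle : ∀ a, M.r a ≤ 0)
    (δ : ℝ) (hδ : 0 < δ) (hgap : ∀ a, a ∉ Set.range πstar → M.r a ≤ -δ)
    (N : ℕ) (hN : 1 ≤ N) (ω : ℝ) (hω : 0 < ω)
    (hmix : ∀ i j : S, ω ≤ ((Matrix.of fun s i => M.p (πstar s) i) ^ N) i j)
    (V : ℕ → S → ℝ) (hVI : ∀ t, V (t + 1) = M.T (V t))
    (hsp : ∀ t < N, 0 < sp (V t)) (hδγ : ∀ t < N, δ ≤ M.γ * sp (V t)) :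
    sp (V N) ≤ M.γ ^ N *
        (1 - (Fintype.card S : ℝ) * ω * δ ^ N /
          (M.γ ^ N * ∏ t ∈ Finset.range N, sp (V t))) * sp (V 0) ∧
    0 ≤ 1 - (Fintype.card S : ℝ) * ω * δ ^ N /
          (M.γ ^ N * ∏ t ∈ Finset.range N, sp (V t)) ∧
    1 - (Fintype.card S : ℝ) * ω * δ ^ N /
          (M.γ ^ N * ∏ t ∈ Finset.range N, sp (V t)) < 1 := by
  set P : Matrix S S ℝ := Matrix.of fun s i => M.p (πstar s) i with hP
  set n : ℝ := (Fintype.card S : ℝ)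
  have hγ := M.γ_pos
  have hn : 0 < n := Nat.cast_pos.2 Fintype.card_pos
  have hP1 : ∀ s, ∑ i, P s i = 1 := fun s => M.p_sum (πstar s)
  have hPN1 : ∀ s, ∑ i, (P ^ N) s i = 1 := fun s => by
    simpa [Matrix.mulVec, dotProduct] using congrFun (pow_mulVec_const hP1 1 N) s
  have hnω : n * ω ≤ 1 := by
    obtain ⟨s⟩ := ‹Nonempty S›
    have h := Finset.sum_le_sum fun i (_ : i ∈ Finset.univ) => hmix s i
    rw [hPN1] at h
    simpa using h
  have hprod : 0 < ∏ t ∈ Finset.range N, sp (V t) :=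
    Finset.prod_pos fun t ht => hsp t (Finset.mem_range.1 ht)
  set C : ℝ := δ ^ N / (M.γ ^ N * ∏ t ∈ Finset.range N, sp (V t)) with hC
  have hC0 : 0 < C := by positivity
  have hC1 : C ≤ 1 := by
    refine (div_le_one (by positivity)).2 ?_
    have h := Finset.prod_le_prod (s := Finset.range N) (fun _ _ => hδ.le)
      fun t ht => hδγ t (Finset.mem_range.1 ht)
    simpa [Finset.prod_mul_distrib] using h
  have hCγ : ∏ k ∈ Finset.range N, δ / sp (V k) = M.γ ^ N * C := by
    rw [Finset.prod_div_distrib, Finset.prod_const, Finset.card_range, hC]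
    field_simp
  rw [mul_div_assoc, ← hC]
  refine ⟨sp_le fun i j => ?_, ?_, ?_⟩
  · obtain ⟨b, -, hb⟩ := Finset.exists_mem_eq_sup' Finset.univ_nonempty (V 0)
    have hB : ∀ s, V 0 s ≤ V 0 b := fun s => hb ▸ Finset.le_sup' (V 0) (Finset.mem_univ s)
    have hup := FMDP.prod_mul_pow_mulVec_le hπstar hr0 hrle hδ hgap hVI hB hsp hδγ N le_rfl i
    have hlow := FMDP.pow_mul_pow_mulVec_le hπstar hr0 hVI N j
    rw [← hP] at hup hlow
    have hsub : (P ^ N).mulVec (fun i => V 0 b - V 0 i) j = V 0 b - (P ^ N).mulVec (V 0) j := by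
      change (P ^ N).mulVec ((fun _ => V 0 b) - V 0) j = _
      rw [Matrix.mulVec_sub, pow_mulVec_const hP1, Pi.sub_apply]
    have hyi := mul_sum_le_mulVec hmix (fun k => sub_nonneg.2 (hB k)) i
    have hyj := mulVec_le_of_entry_ge hmix hPN1 (fun k => sub_le_sp (V 0) b k) j
    rw [hsub] at hyj
    have hG : ∑ k, (V 0 b - V 0 k) ≤ n * sp (V 0) := by
      simpa using Finset.sum_le_card_nsmul Finset.univ _ _ fun k _ => sub_le_sp (V 0) b k
    rw [hCγ, mul_assoc] at hup
    have hmain : V 0 b - (P ^ N).mulVec (V 0) j -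
        C * (P ^ N).mulVec (fun i => V 0 b - V 0 i) i ≤ (1 - n * ω * C) * sp (V 0) := by
      have h1 := mul_le_mul_of_nonneg_left hyi hC0.le
      have h2 := mul_le_mul_of_nonneg_left hG (mul_nonneg (sub_nonneg.2 hC1) hω.le)
      linarith
    have h := mul_le_mul_of_nonneg_left hmain (pow_pos hγ N).le
    linarith
  · have := mul_le_mul hnω hC1 hC0.le zero_le_one
    linarith
  · have : 0 < n * ω * C := by positivity
    linarith
end

section
/- Let M be an n×n real matrix whose rows each sum to 1 and whose entries are all at least φ for some φ ≥ 0 (so in particular n·φ ≤ 1 and M is row-stochastic). Then for every vector V ∈ ℝ^n, sp(M V) ≤ (1 − n·φ)·sp(V), where sp(W) = max_i W(i) − min_i W(i). -/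
/-- Upper bound on an average of `V` whose weights are all at least `φ`. -/
theorem sum_mul_le_of_le_weights {S : Type} [Fintype S] {w V : S → ℝ} {φ b : ℝ}
    (hsum : ∑ j, w j = 1) (hw : ∀ j, φ ≤ w j) (hV : ∀ j, V j ≤ b) :
    ∑ j, w j * V j ≤ b - φ * ∑ j, (b - V j) := by
  have h : φ * ∑ j, (b - V j) ≤ ∑ j, w j * (b - V j) := by
    rw [Finset.mul_sum]
    exact Finset.sum_le_sum fun j _ =>
      mul_le_mul_of_nonneg_right (hw j) (sub_nonneg.2 (hV j))
  have e : ∑ j, w j * (b - V j) = b - ∑ j, w j * V j := by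
    simp only [mul_sub, Finset.sum_sub_distrib, ← Finset.sum_mul, hsum, one_mul]
  linarith

/-- Lower bound on an average of `V` whose weights are all at least `φ`. -/
theorem le_sum_mul_of_le_weights {S : Type} [Fintype S] {w V : S → ℝ} {φ a : ℝ}
    (hsum : ∑ j, w j = 1) (hw : ∀ j, φ ≤ w j) (hV : ∀ j, a ≤ V j) :
    a + φ * ∑ j, (V j - a) ≤ ∑ j, w j * V j := by
  have h := sum_mul_le_of_le_weights (V := fun j => -V j) hsum hw fun j => neg_le_neg (hV j)
  simp only [mul_neg, Finset.sum_neg_distrib, neg_sub_neg] at h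
  linarith

/-- Span contraction for a row-stochastic matrix all of whose entries are at
least `φ ≥ 0`: `sp(M V) ≤ (1 - n φ) sp(V)`. -/
theorem stmt_9 {S : Type} [Fintype S] [Nonempty S]
    (M : Matrix S S ℝ) (φ : ℝ) (hφ : 0 ≤ φ)
    (hrow : ∀ i, ∑ j, M i j = 1) (hent : ∀ i j, φ ≤ M i j)
    (V : S → ℝ) :
    sp (M.mulVec V) ≤ (1 - (Fintype.card S : ℝ) * φ) * sp V := by
  have hmax : ∀ j, V j ≤ Finset.univ.sup' Finset.univ_nonempty V :=
    fun j => Finset.le_sup' V (Finset.mem_univ j)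
  have hmin : ∀ j, Finset.univ.inf' Finset.univ_nonempty V ≤ V j :=
    fun j => Finset.inf'_le V (Finset.mem_univ j)
  have hupper := Finset.sup'_le Finset.univ_nonempty (M.mulVec V) fun i _ =>
    sum_mul_le_of_le_weights (hrow i) (hent i) hmax
  have hlower := Finset.le_inf' Finset.univ_nonempty (M.mulVec V) fun i _ =>
    le_sum_mul_of_le_weights (hrow i) (hent i) hmin
  simp only [Finset.sum_sub_distrib, Finset.sum_const, Finset.card_univ, nsmul_eq_mul]
    at hupper hlower
  unfold sp
  linarith
end

section
/- Consider a finite discounted MDP with state set S, discount factor γ ∈ (0,1), and for each action a a probability vector p^a and coefficient vector c^a given by c^a_i = γ p^a_i − 1 if i = st(a) and c^a_i = γ p^a_i otherwise. Let a_1 and a_2 be two actions and V : S → ℝ a value vector. If st(a_1) = st(a_2), then | Σ_i (c^{a_1}_i − c^{a_2}_i) V(i) | ≤ γ·sp(V); if st(a_1) ≠ st(a_2), then | Σ_i (c^{a_1}_i − c^{a_2}_i) V(i) | ≤ (1+γ)·sp(V). Equivalently, |(Adv(a_1,V) − Adv(a_2,V)) − (r^{a_1} − r^{a_2})| is bounded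 by γ·sp(V) in the first case and by (1+γ)·sp(V) in the second, where Adv(a,V) = r^a + Σ_i c^a_i V(i). -/
/-- Two numbers lying between the extreme values of `V` differ by at most the span of `V`. -/
theorem abs_sub_le_sp {S : Type} [Fintype S] [Nonempty S] {V : S → ℝ} {x y : ℝ}
    (hx : x ∈ Set.Icc (Finset.univ.inf' Finset.univ_nonempty V)
      (Finset.univ.sup' Finset.univ_nonempty V))
    (hy : y ∈ Set.Icc (Finset.univ.inf' Finset.univ_nonempty V)
      (Finset.univ.sup' Finset.univ_nonempty V)) :
    |x - y| ≤ sp V :=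
  abs_sub_le_of_le_of_le hx.1 hx.2 hy.1 hy.2

theorem apply_mem_Icc_inf_sup {S : Type} [Fintype S] [Nonempty S] (V : S → ℝ) (i : S) :
    V i ∈ Set.Icc (Finset.univ.inf' Finset.univ_nonempty V)
      (Finset.univ.sup' Finset.univ_nonempty V) :=
  ⟨Finset.inf'_le V (Finset.mem_univ i), Finset.le_sup' V (Finset.mem_univ i)⟩

/-- A weighted average of `V` lies between the extreme values of `V`. -/
theorem sum_mul_mem_Icc_inf_sup {S : Type} [Fintype S] [Nonempty S] {q : S → ℝ}
    (hq0 : ∀ i, 0 ≤ q i) (hq1 : ∑ i, q i = 1) (V : S → ℝ) :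
    ∑ i, q i * V i ∈ Set.Icc (Finset.univ.inf' Finset.univ_nonempty V)
      (Finset.univ.sup' Finset.univ_nonempty V) :=
  (convex_Icc _ _).sum_mem (fun i _ => hq0 i) hq1 fun i _ => apply_mem_Icc_inf_sup V i

/-- The advantage-difference lemma: with coefficient vectors
`c^a_i = γ p^a_i - [i = st a]`, for any two actions `a₁, a₂` and value vector
`V`, `|∑ i (c^{a₁}_i - c^{a₂}_i) V i| ≤ γ sp(V)` if the actions share a state,
and `≤ (1+γ) sp(V)` otherwise. Equivalently, this quantity is
`(Adv(a₁,V) - Adv(a₂,V)) - (r^{a₁} - r^{a₂})`. -/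
theorem stmt_10 {S A : Type} [Fintype S] [Nonempty S] [DecidableEq S] [Fintype A]
    (st : A → S)
    (p : A → S → ℝ) (hp0 : ∀ a i, 0 ≤ p a i) (hp1 : ∀ a, ∑ i, p a i = 1)
    (r : A → ℝ) (γ : ℝ) (hγ0 : 0 < γ) (hγ1 : γ < 1)
    (c : A → S → ℝ)
    (hc : ∀ a i, c a i = if i = st a then γ * p a i - 1 else γ * p a i)
    (a₁ a₂ : A) (V : S → ℝ) :
    (st a₁ = st a₂ → |∑ i, (c a₁ i - c a₂ i) * V i| ≤ γ * sp V) ∧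
    (st a₁ ≠ st a₂ → |∑ i, (c a₁ i - c a₂ i) * V i| ≤ (1 + γ) * sp V) ∧
    (r a₁ + ∑ i, c a₁ i * V i) - (r a₂ + ∑ i, c a₂ i * V i) - (r a₁ - r a₂) =
      ∑ i, (c a₁ i - c a₂ i) * V i := by
  have hsum (a : A) : ∑ i, c a i * V i = γ * ∑ i, p a i * V i - V (st a) := by
    have hterm (i : S) :
        c a i * V i = γ * (p a i * V i) - if i = st a then V i else 0 := by
      rw [hc]
      split_ifs <;> ring
    simp [hterm, Finset.sum_sub_distrib, Finset.mul_sum]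
  have hdiff : ∑ i, (c a₁ i - c a₂ i) * V i =
      γ * (∑ i, p a₁ i * V i - ∑ i, p a₂ i * V i) - (V (st a₁) - V (st a₂)) := by
    simp only [sub_mul, Finset.sum_sub_distrib, hsum]
    ring
  have hmean : |γ * (∑ i, p a₁ i * V i - ∑ i, p a₂ i * V i)| ≤ γ * sp V := by
    rw [abs_mul, abs_of_pos hγ0]
    exact mul_le_mul_of_nonneg_left
      (abs_sub_le_sp (sum_mul_mem_Icc_inf_sup (hp0 a₁) (hp1 a₁) V)
        (sum_mul_mem_Icc_inf_sup (hp0 a₂) (hp1 a₂) V)) hγ0.le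
  refine ⟨fun h => ?_, fun _ => ?_, ?_⟩
  · rw [hdiff, h, sub_self, sub_zero]
    exact hmean
  · rw [hdiff]
    have hstate := abs_sub_le_sp (apply_mem_Icc_inf_sup V (st a₁))
      (apply_mem_Icc_inf_sup V (st a₂))
    linarith [abs_sub (γ * (∑ i, p a₁ i * V i - ∑ i, p a₂ i * V i)) (V (st a₁) - V (st a₂))]
  · simp only [sub_mul, Finset.sum_sub_distrib]
    ring
end

section
/- Consider a finite discounted MDP that is normalized with optimal policy π*: r^{π*(s)} = 0 for all states s and r^a ≤ 0 for all actions a. Let V : S → ℝ be any value vector, let s be a state, and let a be an action at s that maximizes Adv(·, V) among all actions at s. Then r^a ≥ −γ·sp(V). -/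
theorem inf'_le_sum_mul {S : Type} [Fintype S] [Nonempty S] (q V : S → ℝ)
    (hq0 : ∀ i, 0 ≤ q i) (hq1 : ∑ i, q i = 1) :
    Finset.univ.inf' Finset.univ_nonempty V ≤ ∑ i, q i * V i := by
  calc Finset.univ.inf' Finset.univ_nonempty V
      = ∑ i, q i * Finset.univ.inf' Finset.univ_nonempty V := by
        rw [← Finset.sum_mul, hq1, one_mul]
    _ ≤ ∑ i, q i * V i := Finset.sum_le_sum fun i hi =>
        mul_le_mul_of_nonneg_left (Finset.inf'_le V hi) (hq0 i)

theorem sum_mul_le_sup' {S : Type} [Fintype S] [Nonempty S] (q V : S → ℝ)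
    (hq0 : ∀ i, 0 ≤ q i) (hq1 : ∑ i, q i = 1) :
    ∑ i, q i * V i ≤ Finset.univ.sup' Finset.univ_nonempty V := by
  calc ∑ i, q i * V i
      ≤ ∑ i, q i * Finset.univ.sup' Finset.univ_nonempty V := Finset.sum_le_sum fun i hi =>
        mul_le_mul_of_nonneg_left (Finset.le_sup' V hi) (hq0 i)
    _ = Finset.univ.sup' Finset.univ_nonempty V := by
        rw [← Finset.sum_mul, hq1, one_mul]

/-- In a normalized MDP (`r^{π*(s)} = 0` for all `s`, `r^a ≤ 0` for all `a`),
any action `a` maximizing the advantage `Adv(·,V)` at its state satisfies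
`r^a ≥ -γ·sp(V)`. -/
theorem stmt_12 {S A : Type} [Fintype S] [Nonempty S] [Fintype A]
    (st : A → S) (hst : ∀ s : S, ∃ a, st a = s)
    (p : A → S → ℝ) (hp0 : ∀ a i, 0 ≤ p a i) (hp1 : ∀ a, ∑ i, p a i = 1)
    (r : A → ℝ) (γ : ℝ) (hγ0 : 0 < γ) (hγ1 : γ < 1)
    (πstar : S → A) (hπstar : ∀ s, st (πstar s) = s)
    (hr0 : ∀ s, r (πstar s) = 0) (hrle : ∀ a, r a ≤ 0)
    (V : S → ℝ) (s : S) (a : A) (has : st a = s)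
    (hmax : ∀ a', st a' = s →
      r a' + γ * ∑ i, p a' i * V i - V s ≤ r a + γ * ∑ i, p a i * V i - V s) :
    -(γ * sp V) ≤ r a := by
  have h := hmax (πstar s) (hπstar s)
  rw [hr0] at h
  have hlow := mul_le_mul_of_nonneg_left
    (inf'_le_sum_mul (p (πstar s)) V (hp0 _) (hp1 _)) hγ0.le
  have hupp := mul_le_mul_of_nonneg_left
    (sum_mul_le_sup' (p a) V (hp0 _) (hp1 _)) hγ0.le
  rw [sp, mul_sub]
  linarith
end

section
/- Consider a finite discounted MDP that is normalized with optimal policy π*: r^{π*(s)} = 0 for all states s and r^a ≤ 0 for all actions a (so V^{π*} = 0 and π* is optimal). Let V : S → ℝ and let π be a greedy policy with respect to V, i.e., for each state s, π(s) maximizes Adv(·, V) among all actions at s. Then π is γ·sp(V)/(1−γ)-optimal: for every state s, V^{π*}(s) − V^{π}(s) = −V^{π}(s) ≤ γ·sp(V)/(1−γ). -/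
/-- A weighted average is at least any lower bound of the values. -/
theorem le_weighted_sum_of_forall_le {S : Type} [Fintype S] {q W : S → ℝ} {c : ℝ}
    (hq0 : ∀ i, 0 ≤ q i) (hq1 : ∑ i, q i = 1) (hW : ∀ i, c ≤ W i) :
    c ≤ ∑ i, q i * W i := by
  calc c = ∑ i, q i * c := by rw [← Finset.sum_mul, hq1, one_mul]
    _ ≤ ∑ i, q i * W i :=
      Finset.sum_le_sum fun i _ => mul_le_mul_of_nonneg_left (hW i) (hq0 i)

/-- A weighted average is at most any upper bound of the values. -/
theorem weighted_sum_le_of_forall_le {S : Type} [Fintype S] {q W : S → ℝ} {c : ℝ}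
    (hq0 : ∀ i, 0 ≤ q i) (hq1 : ∑ i, q i = 1) (hW : ∀ i, W i ≤ c) :
    ∑ i, q i * W i ≤ c := by
  calc ∑ i, q i * W i ≤ ∑ i, q i * c :=
      Finset.sum_le_sum fun i _ => mul_le_mul_of_nonneg_left (hW i) (hq0 i)
    _ = c := by rw [← Finset.sum_mul, hq1, one_mul]

/-- Comparison principle: if every one-step reward is at least `c`, then every value is at
least `c / (1 - γ)`. -/
theorem div_one_sub_le_of_bellman {S : Type} [Fintype S] [Nonempty S]
    {P : S → S → ℝ} (hP0 : ∀ s i, 0 ≤ P s i) (hP1 : ∀ s, ∑ i, P s i = 1)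
    {γ : ℝ} (hγ0 : 0 ≤ γ) (hγ1 : γ < 1) {W : S → ℝ} {c : ℝ}
    (hW : ∀ s, c + γ * ∑ i, P s i * W i ≤ W s) (s : S) : c / (1 - γ) ≤ W s := by
  obtain ⟨m, hm⟩ := Finite.exists_min W
  have h := mul_le_mul_of_nonneg_left
    (le_weighted_sum_of_forall_le (hP0 m) (hP1 m) hm) hγ0
  refine le_trans ?_ (hm s)
  rw [div_le_iff₀ (by linarith)]
  linarith [hW m]

/-- In a normalized MDP (`r^{π*(s)} = 0` for all `s`, `r^a ≤ 0` for all `a`, so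
`V^{π*} = 0`), any policy `π` greedy with respect to a value vector `V` is
`γ·sp(V)/(1-γ)`-optimal: `V^{π*}(s) - V^π(s) = -V^π(s) ≤ γ·sp(V)/(1-γ)`. -/
theorem stmt_13 {S A : Type} [Fintype S] [Nonempty S] [Fintype A]
    (st : A → S) (hst : ∀ s : S, ∃ a, st a = s)
    (p : A → S → ℝ) (hp0 : ∀ a i, 0 ≤ p a i) (hp1 : ∀ a, ∑ i, p a i = 1)
    (r : A → ℝ) (γ : ℝ) (hγ0 : 0 < γ) (hγ1 : γ < 1)
    (πstar : S → A) (hπstar : ∀ s, st (πstar s) = s)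
    (hr0 : ∀ s, r (πstar s) = 0) (hrle : ∀ a, r a ≤ 0)
    (V : S → ℝ) (π : S → A) (hπ : ∀ s, st (π s) = s)
    (hgreedy : ∀ s a, st a = s →
      r a + γ * ∑ i, p a i * V i - V s ≤
        r (π s) + γ * ∑ i, p (π s) i * V i - V s)
    (Vstar Vπ : S → ℝ)
    (hVstar : ∀ s, Vstar s = r (πstar s) + γ * ∑ i, p (πstar s) i * Vstar i)
    (hVπ : ∀ s, Vπ s = r (π s) + γ * ∑ i, p (π s) i * Vπ i) :
    (∀ s, Vstar s = 0) ∧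
    ∀ s, Vstar s - Vπ s ≤ γ * sp V / (1 - γ) := by
  have hzero : ∀ s, Vstar s = 0 := by
    intro s
    have hlo := div_one_sub_le_of_bellman (P := fun s => p (πstar s)) (W := Vstar) (c := 0)
      (fun s => hp0 (πstar s)) (fun s => hp1 (πstar s)) hγ0.le hγ1
      (fun s => by rw [hVstar s, hr0]) s
    have hhi := div_one_sub_le_of_bellman (P := fun s => p (πstar s)) (W := fun s => -Vstar s)
      (c := 0) (fun s => hp0 (πstar s)) (fun s => hp1 (πstar s)) hγ0.le hγ1
      (fun s => by
        have h := hVstar s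
        rw [hr0] at h
        simp only [mul_neg, Finset.sum_neg_distrib]
        linarith) s
    rw [zero_div] at hlo hhi
    linarith
  refine ⟨hzero, fun s => ?_⟩
  have hreward : ∀ s, -(γ * sp V) ≤ r (π s) := by
    intro s
    have hmin := mul_le_mul_of_nonneg_left
      (le_weighted_sum_of_forall_le (c := Finset.univ.inf' Finset.univ_nonempty V)
        (hp0 (πstar s)) (hp1 (πstar s)) fun i => Finset.inf'_le V (Finset.mem_univ i)) hγ0.le
    have hmax := mul_le_mul_of_nonneg_left
      (weighted_sum_le_of_forall_le (c := Finset.univ.sup' Finset.univ_nonempty V)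
        (hp0 (π s)) (hp1 (π s)) fun i => Finset.le_sup' V (Finset.mem_univ i)) hγ0.le
    have hg := hgreedy s (πstar s) (hπstar s)
    rw [hr0] at hg
    rw [sp, mul_sub]
    linarith
  have h := div_one_sub_le_of_bellman (P := fun s => p (π s)) (W := Vπ) (c := -(γ * sp V))
    (fun s => hp0 (π s)) (fun s => hp1 (π s)) hγ0.le hγ1
    (fun s => by rw [hVπ s]; linarith [hreward s]) s
  rw [neg_div] at h
  rw [hzero s]
  linarith
end

section
/- Consider a finite discounted MDP with n ≥ 2 states, normalized with optimal policy π* and advantage gap δ > 0 (r^{π*(s)} = 0 for all s, r^a ≤ −δ for all actions a not in the range of π*). Let P* be the stochastic matrix with rows p^{π*(s)} and assume P* is irreducible (for all states i, j there exists k ≥ 1 with ((P*)^k)_{ij} > 0). Fix a learning rate α ∈ (0,1), let V_0 : S → ℝ with sp(V_0) > 0, and define V_{t+1} = (1−α)·V_t + α·T V_t. Then there exists τ ∈ [0,1) such that sp(V_{n−1}) ≤ ((1−α) + αγ)^{n−1} · τ · sp(V_0). -/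
/-- If a matrix has no nonzero entry from outside `B` into `B`, neither do its powers. -/
lemma pow_apply_eq_zero_of_no_entry {S : Type} [Fintype S] [DecidableEq S] (P : Matrix S S ℝ)
    (B : Finset S) (hB : ∀ i ∉ B, ∀ j ∈ B, P i j = 0) (k : ℕ) :
    ∀ i ∉ B, ∀ j ∈ B, (P ^ k) i j = 0 := by
  induction k with
  | zero =>
    intro i hi j hj
    have hij : i ≠ j := by rintro rfl; exact hi hj
    simp [hij]
  | succ k ih =>
    intro i hi j hj
    rw [pow_succ', Matrix.mul_apply]
    refine Finset.sum_eq_zero fun l _ => ?_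
    by_cases hl : l ∈ B
    · rw [hB i hi l hl, zero_mul]
    · rw [ih l hl j hj, mul_zero]

/-- In a normalized MDP, `T` is bounded above by `γ` times any upper bound of a value vector. -/
lemma FMDP.T_le {S A : Type} [Fintype S] [Fintype A] [DecidableEq S] (M : FMDP S A)
    (hrle : ∀ a, M.r a ≤ 0) (V : S → ℝ) (b : ℝ) (hb : ∀ i, V i ≤ b) (s : S) :
    M.T V s ≤ M.γ * b := by
  refine Finset.sup'_le _ _ fun a _ => ?_
  have h : ∑ i, M.p a i * V i ≤ b := calc
    ∑ i, M.p a i * V i ≤ ∑ i, M.p a i * b :=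
      Finset.sum_le_sum fun i _ => mul_le_mul_of_nonneg_left (hb i) (M.p_nonneg a i)
    _ = b := by rw [← Finset.sum_mul, M.p_sum, one_mul]
  have := mul_le_mul_of_nonneg_left h M.γ_pos.le
  linarith [hrle a]

/-- `T` dominates the one-step lookahead of every available zero-reward action. -/
lemma FMDP.le_T_s14 {S A : Type} [Fintype S] [Fintype A] [DecidableEq S] (M : FMDP S A)
    (V : S → ℝ) (a : A) (ha : M.r a = 0) :
    M.γ * ∑ i, M.p a i * V i ≤ M.T V (M.st a) := by
  have h := Finset.le_sup' (s := Finset.univ.filter fun b => M.st b = M.st a)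
    (fun a => M.r a + M.γ * ∑ i, M.p a i * V i) (b := a) (by simp)
  rwa [ha, zero_add] at h

/-- The expectation of `V` is at least any lower bound of `V`. -/
lemma FMDP.le_sum_p_mul {S A : Type} [Fintype S] [Fintype A] (M : FMDP S A)
    (V : S → ℝ) (b : ℝ) (hb : ∀ i, b ≤ V i) (a : A) : b ≤ ∑ i, M.p a i * V i := calc
  b = ∑ i, M.p a i * b := by rw [← Finset.sum_mul, M.p_sum, one_mul]
  _ ≤ _ := Finset.sum_le_sum fun i _ => mul_le_mul_of_nonneg_left (hb i) (M.p_nonneg a i)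

/-- The expectation of `V` exceeds a lower bound that is strict at some state of positive probability. -/
lemma FMDP.lt_sum_p_mul {S A : Type} [Fintype S] [Fintype A] (M : FMDP S A)
    (V : S → ℝ) (b : ℝ) (hb : ∀ i, b ≤ V i) (a : A) (j : S) (hj : b < V j) (hp : 0 < M.p a j) :
    b < ∑ i, M.p a i * V i := calc
  b = ∑ i, M.p a i * b := by rw [← Finset.sum_mul, M.p_sum, one_mul]
  _ < _ := Finset.sum_lt_sum (fun i _ => mul_le_mul_of_nonneg_left (hb i) (M.p_nonneg a i))
    ⟨j, Finset.mem_univ j, mul_lt_mul_of_pos_left hj hp⟩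

lemma sp_nonneg {S : Type} [Fintype S] [Nonempty S] (V : S → ℝ) : 0 ≤ sp V :=
  sub_nonneg.2 ((Finset.inf'_le V (Finset.mem_univ (Classical.arbitrary S))).trans
    (Finset.le_sup' V (Finset.mem_univ _)))

/-- Synchronous Value Iteration with learning rate `α ∈ (0,1)` in a normalized
MDP with advantage gap `δ` whose optimal transition matrix `P*` is irreducible:
after `n - 1` iterations the span contracts by `((1-α) + αγ)^{n-1} · τ` for
some `τ ∈ [0,1)`. -/
theorem stmt_14 {S A : Type} [Fintype S] [Nonempty S] [DecidableEq S] [Fintype A]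
    (M : FMDP S A) (hn : 2 ≤ Fintype.card S)
    (πstar : S → A) (hπstar : ∀ s, M.st (πstar s) = s)
    (hr0 : ∀ s, M.r (πstar s) = 0) (hrle : ∀ a, M.r a ≤ 0)
    (δ : ℝ) (hδ : 0 < δ) (hgap : ∀ a, a ∉ Set.range πstar → M.r a ≤ -δ)
    (hirr : ∀ i j : S, ∃ k : ℕ, 1 ≤ k ∧
      0 < ((Matrix.of fun s i => M.p (πstar s) i) ^ k) i j)
    (α : ℝ) (hα0 : 0 < α) (hα1 : α < 1)
    (V : ℕ → S → ℝ) (hsp0 : 0 < sp (V 0))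
    (hVI : ∀ t s, V (t + 1) s = (1 - α) * V t s + α * M.T (V t) s) :
    ∃ τ : ℝ, 0 ≤ τ ∧ τ < 1 ∧
      sp (V (Fintype.card S - 1)) ≤
        ((1 - α) + α * M.γ) ^ (Fintype.card S - 1) * τ * sp (V 0) := by
  set β : ℝ := (1 - α) + α * M.γ with hβ
  have hβ0 : 0 < β := by have := mul_pos hα0 M.γ_pos; linarith
  set top := Finset.univ.sup' Finset.univ_nonempty (V 0)
  set bot := Finset.univ.inf' Finset.univ_nonempty (V 0)
  have upper : ∀ t s, V t s ≤ β ^ t * top := by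
    intro t
    induction t with
    | zero => intro s; simpa using Finset.le_sup' (V 0) (Finset.mem_univ s)
    | succ t ih =>
      intro s
      have h1 := mul_le_mul_of_nonneg_left (ih s) (sub_nonneg.2 hα1.le)
      have h2 := mul_le_mul_of_nonneg_left (M.T_le hrle (V t) _ ih s) hα0.le
      have h3 : β ^ (t + 1) * top
          = (1 - α) * (β ^ t * top) + α * (M.γ * (β ^ t * top)) := by
        rw [pow_succ, hβ]; ring
      rw [hVI, h3]
      exact add_le_add h1 h2
  have split (t : ℕ) : β ^ (t + 1) * bot
      = (1 - α) * (β ^ t * bot) + α * (M.γ * (β ^ t * bot)) := by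
    rw [pow_succ, hβ]; ring
  have lookahead (t : ℕ) (s : S) :
      M.γ * ∑ i, M.p (πstar s) i * V t i ≤ M.T (V t) s := by
    simpa only [hπstar] using M.le_T_s14 (V t) (πstar s) (hr0 s)
  have lower : ∀ t s, β ^ t * bot ≤ V t s := by
    intro t
    induction t with
    | zero => intro s; simpa using Finset.inf'_le (V 0) (Finset.mem_univ s)
    | succ t ih =>
      intro s
      have h1 := mul_le_mul_of_nonneg_left (ih s) (sub_nonneg.2 hα1.le)
      have h2 := mul_le_mul_of_nonneg_left
        ((mul_le_mul_of_nonneg_left (M.le_sum_p_mul (V t) _ ih (πstar s)) M.γ_pos.le).trans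
          (lookahead t s)) hα0.le
      rw [hVI, split]
      exact add_le_add h1 h2
  let above (t : ℕ) : Finset S := Finset.univ.filter fun s => β ^ t * bot < V t s
  have mem_above (t : ℕ) (s : S) : s ∈ above t ↔ β ^ t * bot < V t s := by simp [above]
  have above_mono (t : ℕ) : above t ⊆ above (t + 1) := by
    intro s hs
    rw [mem_above] at hs ⊢
    have h1 := mul_lt_mul_of_pos_left hs (sub_pos.2 hα1)
    have h2 := mul_le_mul_of_nonneg_left
      ((mul_le_mul_of_nonneg_left
        (M.le_sum_p_mul (V t) _ (lower t) (πstar s)) M.γ_pos.le).trans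
        (lookahead t s)) hα0.le
    rw [hVI, split]
    exact add_lt_add_of_lt_of_le h1 h2
  have card_above (t : ℕ) : min (t + 1) (Fintype.card S) ≤ (above t).card := by
    induction t with
    | zero =>
      refine (min_le_left _ _).trans (Finset.card_pos.2 ?_)
      obtain ⟨s, -, hs⟩ := Finset.exists_mem_eq_sup' Finset.univ_nonempty (V 0)
      refine ⟨s, (mem_above 0 s).2 ?_⟩
      have h : 0 < top - bot := hsp0
      rw [pow_zero, one_mul, ← hs]
      linarith
    | succ t ih =>
      by_cases hfull : above t = Finset.univ
      · have := Finset.card_le_card (above_mono t)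
        rw [hfull, Finset.card_univ] at this
        exact (min_le_right _ _).trans this
      have hcard : 0 < (above t).card := by omega
      obtain ⟨j, hj⟩ := Finset.card_pos.1 hcard
      obtain ⟨i, hi⟩ : ∃ i, i ∉ above t := by
        by_contra! h
        exact hfull (Finset.eq_univ_iff_forall.2 h)
      obtain ⟨s, hs, l, hl, hsl⟩ : ∃ s ∉ above t, ∃ l ∈ above t, M.p (πstar s) l ≠ 0 := by
        by_contra! h
        obtain ⟨k, -, hk⟩ := hirr i j
        exact hk.ne' (pow_apply_eq_zero_of_no_entry _ (above t) h k i hi j hj)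
      have hs' : s ∈ above (t + 1) := by
        rw [mem_above] at hl ⊢
        have h1 := mul_le_mul_of_nonneg_left (lower t s) (sub_nonneg.2 hα1.le)
        have h2 := mul_lt_mul_of_pos_left
          ((mul_lt_mul_of_pos_left (M.lt_sum_p_mul (V t) _ (lower t) (πstar s) l hl
            ((M.p_nonneg _ _).lt_of_ne' hsl)) M.γ_pos).trans_le (lookahead t s)) hα0
        rw [hVI, split]
        exact add_lt_add_of_le_of_lt h1 h2
      have := Finset.card_lt_card
        ((Finset.ssubset_iff_of_subset (above_mono t)).2 ⟨s, hs', hs⟩)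
      omega
  set N := Fintype.card S - 1 with hN
  have strict (s : S) : β ^ N * bot < V N s := by
    have hcard := card_above N
    rw [show N + 1 = Fintype.card S by omega, min_self] at hcard
    have huniv := (Finset.card_eq_iff_eq_univ _).1 (le_antisymm (Finset.card_le_univ _) hcard)
    exact (mem_above N s).1 (huniv ▸ Finset.mem_univ s)
  have hmain : sp (V N) < β ^ N * sp (V 0) := by
    have h1 : Finset.univ.sup' Finset.univ_nonempty (V N) ≤ β ^ N * top :=
      Finset.sup'_le _ _ fun s _ => upper N s
    have h2 : β ^ N * bot < Finset.univ.inf' Finset.univ_nonempty (V N) :=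
      (Finset.lt_inf'_iff _).2 fun s _ => strict s
    have h3 : β ^ N * sp (V 0) = β ^ N * top - β ^ N * bot := mul_sub _ _ _
    rw [h3, sp]
    linarith
  have hpos : 0 < β ^ N * sp (V 0) := mul_pos (pow_pos hβ0 N) hsp0
  refine ⟨sp (V N) / (β ^ N * sp (V 0)), div_nonneg (sp_nonneg _) hpos.le,
    (div_lt_one hpos).2 hmain, ?_⟩
  rw [mul_right_comm, mul_div_cancel₀ _ hpos.ne']
end

section
/- Consider a finite discounted MDP with exactly two states S = {1, 2} and discount factor γ ∈ (0,1). Let π, π_l, π_r be policies, and let b and c be actions at state 2 with b = π_r(2) and c = π_l(2). Assume V^{π_r}(1) − V^{π_r}(2) ≤ V^{π}(1) − V^{π}(2) ≤ V^{π_l}(1) − V^{π_l}(2) and V^{π_r}(2) > V^{π_l}(2). Then Adv(b, V^π) > Adv(c, V^π). -/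
/-- The inefficiency-zone inequality in a two-state MDP (states `0` and `1`
playing the roles of states `1` and `2`): if the slope of `π` lies between the
slopes of `π_r` and `π_l`, and `π_r` has the larger value at state `1`, then
the action `b = π_r(1)` strictly dominates the action `c = π_l(1)` with respect
to `V^π`. -/
theorem stmt_17 {A : Type} [Fintype A]
    (st : A → Fin 2)
    (p : A → Fin 2 → ℝ) (hp0 : ∀ a i, 0 ≤ p a i) (hp1 : ∀ a, ∑ i, p a i = 1)
    (r : A → ℝ) (γ : ℝ) (hγ0 : 0 < γ) (hγ1 : γ < 1)
    (π πl πr : Fin 2 → A)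
    (hπ : ∀ s, st (π s) = s) (hπl : ∀ s, st (πl s) = s) (hπr : ∀ s, st (πr s) = s)
    (Vπ Vl Vr : Fin 2 → ℝ)
    (hVπ : ∀ s, Vπ s = r (π s) + γ * ∑ i, p (π s) i * Vπ i)
    (hVl : ∀ s, Vl s = r (πl s) + γ * ∑ i, p (πl s) i * Vl i)
    (hVr : ∀ s, Vr s = r (πr s) + γ * ∑ i, p (πr s) i * Vr i)
    (b c : A) (hb : b = πr 1) (hc : c = πl 1)
    (hslope_r : Vr 0 - Vr 1 ≤ Vπ 0 - Vπ 1)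
    (hslope_l : Vπ 0 - Vπ 1 ≤ Vl 0 - Vl 1)
    (hval : Vl 1 < Vr 1) :
    r c + γ * ∑ i, p c i * Vπ i - Vπ (st c) <
      r b + γ * ∑ i, p b i * Vπ i - Vπ (st b) := by
  subst hb hc
  have hr := hVr 1
  have hl := hVl 1
  have hb1 := hp1 (πr 1)
  have hc1 := hp1 (πl 1)
  rw [hπr, hπl]
  simp only [Fin.sum_univ_two] at hr hl hb1 hc1 ⊢
  have eb : p (πr 1) 1 = 1 - p (πr 1) 0 := by linarith
  have ec : p (πl 1) 1 = 1 - p (πl 1) 0 := by linarith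
  rw [eb] at hr ⊢
  rw [ec] at hl ⊢
  have gain_b : 0 ≤ γ * p (πr 1) 0 * ((Vπ 0 - Vπ 1) - (Vr 0 - Vr 1)) :=
    mul_nonneg (mul_nonneg hγ0.le (hp0 _ _)) (sub_nonneg.2 hslope_r)
  have loss_c : 0 ≤ γ * p (πl 1) 0 * ((Vl 0 - Vl 1) - (Vπ 0 - Vπ 1)) :=
    mul_nonneg (mul_nonneg hγ0.le (hp0 _ _)) (sub_nonneg.2 hslope_l)
  have gap : 0 < (1 - γ) * (Vr 1 - Vl 1) := mul_pos (sub_pos.2 hγ1) (sub_pos.2 hval)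
  linarith
end

section
/- Consider a finite discounted MDP and let V* : S → ℝ be the optimal value vector (the unique fixed point of the Bellman optimality operator T). Let a be an action with s = st(a), let V : S → ℝ, and set e = V − V*. If Adv(a, V) + γ·(1 − p^a_s)·sp(e) + (1−γ)·max_i |e(i)| < 0, then Adv(a, V*) < 0; in particular, a does not attain the maximum in (TV*)(s) and therefore belongs to no optimal policy. -/
theorem sub_le_sp_s18 {S : Type} [Fintype S] [Nonempty S] (e : S → ℝ) (s i : S) :
    e s - e i ≤ sp e :=
  sub_le_sub (Finset.le_sup' e (Finset.mem_univ s)) (Finset.inf'_le e (Finset.mem_univ i))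

/-- A value exceeds its average under a probability vector `p` by at most the span times the
mass that `p` puts on the other states. -/
theorem sub_sum_mul_le_sp {S : Type} [Fintype S] [Nonempty S] [DecidableEq S]
    {p : S → ℝ} (hp : ∀ i, 0 ≤ p i) (hsum : ∑ i, p i = 1) (e : S → ℝ) (s : S) :
    e s - ∑ i, p i * e i ≤ (1 - p s) * sp e := by
  have hle : ∑ i, p i * (e s - e i) ≤ ∑ i, (p i * sp e - if i = s then p i * sp e else 0) := by
    refine Finset.sum_le_sum fun i _ => ?_
    split_ifs with h
    · simp [h]
    · simpa using mul_le_mul_of_nonneg_left (sub_le_sp_s18 e s i) (hp i)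
  simp only [mul_sub, Finset.sum_sub_distrib, ← Finset.sum_mul, hsum, Finset.sum_ite_eq',
    Finset.mem_univ, if_true, one_mul] at hle
  linarith

/-- Soundness of the action-filtering criterion: if, with `e = V - V*`,
`Adv(a,V) + γ (1 - p^a_s) sp(e) + (1-γ) max_i |e(i)| < 0`, then
`Adv(a,V*) < 0`; in particular `a` does not attain the maximum in `(TV*)(s)`
and belongs to no optimal policy. -/
theorem stmt_18 {S A : Type} [Fintype S] [Nonempty S] [DecidableEq S] [Fintype A]
    (M : FMDP S A)
    (Vstar : S → ℝ) (hfix : ∀ s, M.T Vstar s = Vstar s)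
    (a : A) (s : S) (has : M.st a = s)
    (V e : S → ℝ) (he : ∀ i, e i = V i - Vstar i)
    (hfilter : (M.r a + M.γ * ∑ i, M.p a i * V i - V s) +
        M.γ * (1 - M.p a s) * sp e +
        (1 - M.γ) * Finset.univ.sup' Finset.univ_nonempty (fun i => |e i|) < 0) :
    M.r a + M.γ * ∑ i, M.p a i * Vstar i - Vstar s < 0 ∧
    M.r a + M.γ * ∑ i, M.p a i * Vstar i ≠ M.T Vstar s ∧
    ∀ (π : S → A) (Vπ : S → ℝ), (∀ i, M.st (π i) = i) →
      (∀ i, Vπ i = M.r (π i) + M.γ * ∑ j, M.p (π i) j * Vπ j) →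
      Vπ = Vstar → π s ≠ a := by
  have hadv : M.r a + M.γ * ∑ i, M.p a i * Vstar i - Vstar s < 0 := by
    have hsplit : ∑ i, M.p a i * e i = ∑ i, M.p a i * V i - ∑ i, M.p a i * Vstar i := by
      simp only [he, mul_sub, Finset.sum_sub_distrib]
    have hspan := mul_le_mul_of_nonneg_left
      (sub_sum_mul_le_sp (M.p_nonneg a) (M.p_sum a) e s) M.γ_pos.le
    have hsup : e s ≤ Finset.univ.sup' Finset.univ_nonempty (fun i => |e i|) :=
      (le_abs_self _).trans (Finset.le_sup' (fun i => |e i|) (Finset.mem_univ s))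
    have hdisc := mul_le_mul_of_nonneg_left hsup (sub_nonneg.mpr M.γ_lt_one.le)
    rw [hsplit] at hspan
    linarith [he s]
  refine ⟨hadv, ?_, ?_⟩
  · rw [hfix s]
    exact (sub_neg.mp hadv).ne
  · rintro π Vπ - hV rfl hπ
    have := hV s
    rw [hπ] at this
    linarith
end
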